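/- Let f ∈ C[x_0,x_1,x_2,x_3] be a squarefree homogeneous polynomial of degree 2d such that V(f) is a nodal surface, and let X : y^2 = f be the double cover of P^3 branched along V(f). If h^4(X, Q) > 1 then X has at least d(2d-1) nodes. -/

import Mathlib

open MvPolynomial

attribute [local instance] MvPolynomial.gradedAlgebra

/-- Hilbert function. -/
noncomputable def hilb (m : ℕ) (I : Ideal (MvPolynomial (Fin m) ℂ)) (k : ℕ) : ℕ :=
  Module.finrank ℂ
    (↥(homogeneousSubmodule (Fin m) ℂ k) ⧸
      Submodule.comap (homogeneousSubmodule (Fin m) ℂ k).subtype (Submodule.restrictScalars ℂ I))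

/-- The Hessian matrix of second partial derivatives of `f`, evaluated at `x`. -/
noncomputable def hessian (m : ℕ) (f : MvPolynomial (Fin m) ℂ) (x : Fin m → ℂ) :
    Matrix (Fin m) (Fin m) ℂ :=
  Matrix.of fun i j => MvPolynomial.eval x (pderiv i (pderiv j f))

/-- The singular locus of `V(f)` in `ℙ^{m-1}`. -/
def singLocus (m : ℕ) (f : MvPolynomial (Fin m) ℂ) : Set (Projectivization ℂ (Fin m → ℂ)) :=
  {p | ∀ i, MvPolynomial.eval p.rep (pderiv i f) = 0}

/-- `V(f)` is nodal: at every singular point the (homogeneous) Hessian has corank one,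
i.e. the singularity is an ordinary double point. -/
def IsNodal (m : ℕ) (f : MvPolynomial (Fin m) ℂ) : Prop :=
  ∀ x : Fin m → ℂ, x ≠ 0 → (∀ i, MvPolynomial.eval x (pderiv i f) = 0) →
    (hessian m f x).rank = m - 1

/-- The homogeneous vanishing ideal of a set of points of `ℙ^{m-1}`
(polynomials vanishing on the affine cone). -/
noncomputable def coneVanishingIdeal (m : ℕ) (Sig : Set (Projectivization ℂ (Fin m → ℂ))) :
    Ideal (MvPolynomial (Fin m) ℂ) :=
  Ideal.span {g | ∀ p ∈ Sig, ∀ t : ℂ, MvPolynomial.eval (t • p.rep) g = 0}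

lemma homogeneousSubmodule_mul_eq {σ : Type*} (j k : ℕ) :
    homogeneousSubmodule σ ℂ j * homogeneousSubmodule σ ℂ k = homogeneousSubmodule σ ℂ (j + k) := by
  rw [← homogeneousSubmodule_one_pow ℂ j, ← homogeneousSubmodule_one_pow ℂ k, ← pow_add,
    homogeneousSubmodule_one_pow]

lemma homogeneousSubmodule_add_le {σ : Type*} {j k : ℕ} {N : Submodule ℂ (MvPolynomial σ ℂ)}
    (h : ∀ F ∈ homogeneousSubmodule σ ℂ j, ∀ G ∈ homogeneousSubmodule σ ℂ k, F * G ∈ N) :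
    homogeneousSubmodule σ ℂ (j + k) ≤ N := by
  rw [← homogeneousSubmodule_mul_eq]
  exact Submodule.mul_le.2 h

lemma homogeneousSubmodule_succ_le {σ : Type*} {k : ℕ} {N : Submodule ℂ (MvPolynomial σ ℂ)}
    (h : ∀ i, ∀ G ∈ homogeneousSubmodule σ ℂ k, X i * G ∈ N) :
    homogeneousSubmodule σ ℂ (k + 1) ≤ N := by
  rw [add_comm, ← homogeneousSubmodule_mul_eq, homogeneousSubmodule_one_eq_span_X, Submodule.mul_le]
  intro F hF G hG
  induction hF using Submodule.span_induction with
  | mem x hx => obtain ⟨i, rfl⟩ := hx; exact h i G hG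
  | zero => simp
  | add x y _ _ hx hy => rw [add_mul]; exact N.add_mem hx hy
  | smul c x _ hx => rw [smul_mul_assoc]; exact N.smul_mem c hx

/-- The family of linear forms parametrised by the moment curve. -/
noncomputable def momentForm (t : ℂ) : MvPolynomial (Fin 3) ℂ :=
  X 0 + t • X 1 + t ^ 2 • X 2

lemma momentForm_mem (t : ℂ) : momentForm t ∈ homogeneousSubmodule (Fin 3) ℂ 1 :=
  Submodule.add_mem _ (Submodule.add_mem _ (isHomogeneous_X _ _)
    (Submodule.smul_mem _ _ (isHomogeneous_X _ _))) (Submodule.smul_mem _ _ (isHomogeneous_X _ _))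

/-- Modulo two moment forms, a form of degree `k` is a multiple of `X 2 ^ k`. -/
lemma sub_smul_pow_mem {a b : ℂ} (hab : a ≠ b) (k : ℕ) {G : MvPolynomial (Fin 3) ℂ}
    (hG : G ∈ homogeneousSubmodule (Fin 3) ℂ (k + 1)) :
    G - aeval ![a * b, -(a + b), 1] G • X 2 ^ (k + 1) ∈
      (homogeneousSubmodule (Fin 3) ℂ k).map (LinearMap.mulLeft ℂ (momentForm a)) ⊔
      (homogeneousSubmodule (Fin 3) ℂ k).map (LinearMap.mulLeft ℂ (momentForm b)) := by
  have hab' : a - b ≠ 0 := sub_ne_zero.2 hab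
  have key : ∀ i : Fin 3, ∃ α β : ℂ, (X i : MvPolynomial (Fin 3) ℂ) -
      (![a * b, -(a + b), 1] : Fin 3 → ℂ) i • X 2 = momentForm a * C α + momentForm b * C β := by
    intro i
    have h1 : (C (a - b) : MvPolynomial (Fin 3) ℂ) * C (a - b)⁻¹ = 1 := by
      rw [← C_mul, mul_inv_cancel₀ hab', C_1]
    fin_cases i
    · refine ⟨-b * (a - b)⁻¹, a * (a - b)⁻¹, ?_⟩
      simp only [momentForm, smul_eq_C_mul, map_mul, map_sub, map_neg, map_pow,
        Fin.zero_eta, Matrix.cons_val_zero] at h1 ⊢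
      linear_combination (C a * C b * X 2 - X 0) * h1
    · refine ⟨(a - b)⁻¹, -(a - b)⁻¹, ?_⟩
      simp only [momentForm, smul_eq_C_mul, map_sub, map_neg, map_pow, map_add,
        Fin.mk_one, Matrix.cons_val_one, Matrix.cons_val_zero] at h1 ⊢
      linear_combination (-(X 1) - (C a + C b) * X 2) * h1
    · refine ⟨0, 0, ?_⟩
      simp
  set q : Fin 3 → ℂ := ![a * b, -(a + b), 1] with hq
  have step : ∀ (n : ℕ) (i : Fin 3), ∀ g ∈ homogeneousSubmodule (Fin 3) ℂ n,
      X i * g - (q i • X 2) * g ∈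
      (homogeneousSubmodule (Fin 3) ℂ n).map (LinearMap.mulLeft ℂ (momentForm a)) ⊔
      (homogeneousSubmodule (Fin 3) ℂ n).map (LinearMap.mulLeft ℂ (momentForm b)) := by
    intro n i g hg
    obtain ⟨α, β, h⟩ := key i
    rw [← sub_mul, h, add_mul]
    refine Submodule.add_mem_sup ⟨α • g, Submodule.smul_mem _ _ hg, ?_⟩
      ⟨β • g, Submodule.smul_mem _ _ hg, ?_⟩ <;>
    simp [smul_eq_C_mul, mul_assoc]
  let D (n : ℕ) : MvPolynomial (Fin 3) ℂ →ₗ[ℂ] MvPolynomial (Fin 3) ℂ :=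
    LinearMap.id - (LinearMap.toSpanSingleton ℂ _ (X 2 ^ n)).comp (aeval q).toLinearMap
  suffices homogeneousSubmodule (Fin 3) ℂ (k + 1) ≤ Submodule.comap (D (k + 1))
      ((homogeneousSubmodule (Fin 3) ℂ k).map (LinearMap.mulLeft ℂ (momentForm a)) ⊔
      (homogeneousSubmodule (Fin 3) ℂ k).map (LinearMap.mulLeft ℂ (momentForm b))) from this hG
  clear hG G
  induction k with
  | zero =>
    refine homogeneousSubmodule_succ_le fun i g hg => ?_
    have := step 0 i g hg
    rw [homogeneousSubmodule_zero, Submodule.mem_one] at hg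
    obtain ⟨c, rfl⟩ := hg
    rw [Submodule.mem_comap]
    convert this using 1
    simp only [D, LinearMap.sub_apply, LinearMap.id_apply, LinearMap.comp_apply,
      LinearMap.toSpanSingleton_apply, AlgHom.toLinearMap_apply, map_mul, aeval_X, aeval_C,
      smul_eq_C_mul, algebraMap_eq, zero_add, pow_one, Algebra.algebraMap_self, RingHom.id_apply]
    ring
  | succ k ih =>
    refine homogeneousSubmodule_succ_le fun i g hg => ?_
    have h1 := step (k + 1) i g hg
    have h2 : (q i • X 2) * D (k + 1) g ∈
        (homogeneousSubmodule (Fin 3) ℂ (k + 1)).map (LinearMap.mulLeft ℂ (momentForm a)) ⊔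
        (homogeneousSubmodule (Fin 3) ℂ (k + 1)).map (LinearMap.mulLeft ℂ (momentForm b)) := by
      have hX : ∀ F ∈ homogeneousSubmodule (Fin 3) ℂ k,
          (q i • X 2) * F ∈ homogeneousSubmodule (Fin 3) ℂ (k + 1) := by
        intro F hF
        rw [add_comm, ← homogeneousSubmodule_mul_eq]
        exact Submodule.mul_mem_mul (Submodule.smul_mem _ _ (isHomogeneous_X _ _)) hF
      obtain ⟨u, ⟨u', hu', rfl⟩, v, ⟨v', hv', rfl⟩, huv⟩ := Submodule.mem_sup.1 (ih hg)
      rw [← huv, mul_add]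
      refine Submodule.add_mem_sup ⟨_, hX u' hu', ?_⟩ ⟨_, hX v' hv', ?_⟩ <;>
      simp only [LinearMap.mulLeft_apply] <;> ring
    rw [Submodule.mem_comap]
    convert Submodule.add_mem _ h1 h2 using 1
    simp only [D, LinearMap.sub_apply, LinearMap.id_apply, LinearMap.comp_apply,
      LinearMap.toSpanSingleton_apply, AlgHom.toLinearMap_apply, map_mul, aeval_X, smul_eq_C_mul]
    ring

/-- A form of degree `n` vanishing under `π`, given by a univariate polynomial. -/
lemma exists_polynomial_of_finrank_le {V : Type*} [AddCommGroup V] [Module ℂ V] (n : ℕ)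
    (π : MvPolynomial (Fin 3) ℂ →ₗ[ℂ] V)
    (h : Module.finrank ℂ ((homogeneousSubmodule (Fin 3) ℂ n).map π) ≤ n) :
    ∃ g ∈ homogeneousSubmodule (Fin 3) ℂ n, π g = 0 ∧ ∃ p : Polynomial ℂ, p ≠ 0 ∧
      ∀ x y : ℂ, aeval ![x, y, 1] g = p.eval x := by
  let θ : (Fin (n + 1) → ℂ) →ₗ[ℂ] MvPolynomial (Fin 3) ℂ :=
    Fintype.linearCombination ℂ fun i : Fin (n + 1) => X 0 ^ (i : ℕ) * X 2 ^ (n - (i : ℕ))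
  have hθ : ∀ c, θ c ∈ homogeneousSubmodule (Fin 3) ℂ n := by
    intro c
    simp only [θ, Fintype.linearCombination_apply]
    refine Submodule.sum_mem _ fun i _ => Submodule.smul_mem _ _ ?_
    have := ((isHomogeneous_X_pow (R := ℂ) (0 : Fin 3) (i : ℕ)).mul
      (isHomogeneous_X_pow (R := ℂ) (2 : Fin 3) (n - i)))
    rwa [Nat.add_sub_cancel' (Nat.lt_succ_iff.1 i.2)] at this
  let θ' : (Fin (n + 1) → ℂ) →ₗ[ℂ] (homogeneousSubmodule (Fin 3) ℂ n).map π :=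
    (π ∘ₗ θ).codRestrict _ fun c => ⟨θ c, hθ c, rfl⟩
  have : Module.Finite ℂ (homogeneousSubmodule (Fin 3) ℂ n) :=
    Module.Finite.iff_fg.2 (homogeneousSubmodule_fg (Fin 3) ℂ n)
  have hker : LinearMap.ker θ' ≠ ⊥ := by
    apply LinearMap.ker_ne_bot_of_finrank_lt
    rw [Module.finrank_fin_fun]
    omega
  obtain ⟨c, hc, hc0⟩ := Submodule.exists_mem_ne_zero_of_ne_bot hker
  refine ⟨θ c, hθ c, congrArg Subtype.val (LinearMap.mem_ker.1 hc),
    ∑ i : Fin (n + 1), Polynomial.monomial (i : ℕ) (c i), ?_, ?_⟩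
  · intro h0
    apply hc0
    ext i
    have := congrArg (fun p => Polynomial.coeff p (i : ℕ)) h0
    simpa [Polynomial.finsetSum_coeff, Polynomial.coeff_monomial, Fin.val_inj] using this
  · intro x y
    simp [θ, Fintype.linearCombination_apply, Polynomial.eval_finsetSum]

/-- Green's hyperplane restriction theorem for small codimension in three variables. -/
lemma finite_setOf_not_map_le {V : Type*} [AddCommGroup V] [Module ℂ V] (k : ℕ)
    (π : MvPolynomial (Fin 3) ℂ →ₗ[ℂ] V)
    (h : Module.finrank ℂ ((homogeneousSubmodule (Fin 3) ℂ (k + 1)).map π) ≤ k + 1) :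
    {t : ℂ | ¬ (homogeneousSubmodule (Fin 3) ℂ (k + 1)).map π ≤
      (homogeneousSubmodule (Fin 3) ℂ k).map (π ∘ₗ LinearMap.mulLeft ℂ (momentForm t))}.Finite := by
  have hfin : ∀ n, Module.Finite ℂ (homogeneousSubmodule (Fin 3) ℂ n) := fun n =>
    Module.Finite.iff_fg.2 (homogeneousSubmodule_fg (Fin 3) ℂ n)
  have hmem : ∀ (n : ℕ) (t : ℂ) (F), F ∈ homogeneousSubmodule (Fin 3) ℂ n →
      momentForm t * F ∈ homogeneousSubmodule (Fin 3) ℂ (n + 1) := by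
    intro n t F hF
    rw [add_comm, ← homogeneousSubmodule_mul_eq]
    exact Submodule.mul_mem_mul (momentForm_mem t) hF
  have core : ∀ (k : ℕ) (π : MvPolynomial (Fin 3) ℂ →ₗ[ℂ] V),
      Module.finrank ℂ ((homogeneousSubmodule (Fin 3) ℂ (k + 1)).map π) ≤ k + 1 →
      (∀ a : ℂ, Module.finrank ℂ ((homogeneousSubmodule (Fin 3) ℂ k).map
          (π ∘ₗ LinearMap.mulLeft ℂ (momentForm a))) ≤ k →
        {t : ℂ | ¬ (homogeneousSubmodule (Fin 3) ℂ k).map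
            (π ∘ₗ LinearMap.mulLeft ℂ (momentForm a)) ≤
          (homogeneousSubmodule (Fin 3) ℂ k).map
            (π ∘ₗ LinearMap.mulLeft ℂ (momentForm t))}.Finite) →
      {t : ℂ | ¬ (homogeneousSubmodule (Fin 3) ℂ (k + 1)).map π ≤
        (homogeneousSubmodule (Fin 3) ℂ k).map
          (π ∘ₗ LinearMap.mulLeft ℂ (momentForm t))}.Finite := by
    intro k π h ih
    by_contra hinf
    obtain ⟨a, ha, ha0⟩ := (Set.not_finite.1 hinf |>.sdiff (Set.finite_singleton 0)).nonempty
    obtain ⟨g, hg, hπg, p, hp, hpg⟩ := exists_polynomial_of_finrank_le (k + 1) π h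
    have hlt : Module.finrank ℂ ((homogeneousSubmodule (Fin 3) ℂ k).map
          (π ∘ₗ LinearMap.mulLeft ℂ (momentForm a))) ≤ k := by
      refine Nat.lt_succ_iff.1 (lt_of_lt_of_le (Submodule.finrank_lt_finrank_of_lt
        (lt_of_le_not_ge ?_ ha)) h)
      rintro _ ⟨F, hF, rfl⟩
      exact ⟨_, hmem _ _ _ hF, rfl⟩
    refine hinf (((ih a hlt).union ((p.roots.toFinset.finite_toSet.image (· / a)).union
      (Set.finite_singleton a))).subset fun b hb => ?_)
    by_contra hbn
    simp only [Set.mem_union, not_or, Set.mem_ofPred_eq, not_not, Set.mem_singleton_iff,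
      Set.mem_image, not_exists, not_and, Finset.mem_coe, Multiset.mem_toFinset] at hbn ha0
    obtain ⟨hb1, hb2, hb3⟩ := hbn
    have hev : aeval ![a * b, -(a + b), 1] g ≠ 0 := by
      rw [hpg]
      intro h0
      exact hb2 (a * b) ((Polynomial.mem_roots hp).2 h0) (by field_simp)
    refine hb ?_
    have hpow : ∀ G ∈ homogeneousSubmodule (Fin 3) ℂ (k + 1),
        π (G - aeval ![a * b, -(a + b), 1] G • X 2 ^ (k + 1)) ∈
        (homogeneousSubmodule (Fin 3) ℂ k).map (π ∘ₗ LinearMap.mulLeft ℂ (momentForm b)) := by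
      intro G hG
      obtain ⟨u, ⟨u', hu', rfl⟩, v, ⟨v', hv', rfl⟩, huv⟩ :=
        Submodule.mem_sup.1 (sub_smul_pow_mem (Ne.symm hb3) k hG)
      rw [← huv, map_add]
      exact Submodule.add_mem _ (hb1 ⟨u', hu', rfl⟩) ⟨v', hv', rfl⟩
    rintro _ ⟨G, hG, rfl⟩
    have h1 := hpow G hG
    have h2 := hpow g hg
    rw [map_sub, hπg, zero_sub, map_smul, Submodule.neg_mem_iff,
      Submodule.smul_mem_iff _ hev] at h2
    rw [map_sub, map_smul] at h1
    exact (Submodule.sub_mem_iff_left _ (Submodule.smul_mem _ _ h2)).1 h1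
  induction k generalizing π with
  | zero =>
    refine core 0 π h fun a ha => ?_
    rw [Nat.le_zero, Submodule.finrank_eq_zero] at ha
    simp only [ha, bot_le, not_true_eq_false]
    exact Set.finite_empty
  | succ k ih =>
    refine core (k + 1) π h fun a ha => ((ih _ ha).subset ?_)
    intro t ht hle
    refine ht (hle.trans ?_)
    rintro _ ⟨F, hF, rfl⟩
    refine ⟨_, hmem _ a _ hF, ?_⟩
    simp only [LinearMap.comp_apply, LinearMap.mulLeft_apply]
    congr 1
    ring

/-- The degree `k` part of a quotient of the polynomial ring in three variables. -/
noncomputable def imageDeg {A : Type*} [CommRing A] [Algebra ℂ A]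
    (π : MvPolynomial (Fin 3) ℂ →ₐ[ℂ] A) (k : ℕ) : Submodule ℂ A :=
  (homogeneousSubmodule (Fin 3) ℂ k).map π.toLinearMap

section GradedImage

variable {A : Type*} [CommRing A] [Algebra ℂ A] {π : MvPolynomial (Fin 3) ℂ →ₐ[ℂ] A}

instance (k : ℕ) : Module.Finite ℂ (imageDeg π k) := by
  have : Module.Finite ℂ (homogeneousSubmodule (Fin 3) ℂ k) :=
    Module.Finite.iff_fg.2 (homogeneousSubmodule_fg (Fin 3) ℂ k)
  unfold imageDeg
  infer_instance

lemma mem_imageDeg {k : ℕ} {F : MvPolynomial (Fin 3) ℂ} (hF : F ∈ homogeneousSubmodule (Fin 3) ℂ k) :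
    π F ∈ imageDeg π k :=
  ⟨F, hF, rfl⟩

lemma imageDeg_mul (j k : ℕ) : imageDeg π j * imageDeg π k = imageDeg π (j + k) := by
  rw [imageDeg, imageDeg, imageDeg, ← homogeneousSubmodule_mul_eq, Submodule.map_mul]

lemma one_mem_imageDeg : (1 : A) ∈ imageDeg π 0 := by
  rw [← map_one π]
  exact mem_imageDeg (isHomogeneous_one _ _)

lemma imageDeg_succ_le_of_le {k j : ℕ} {l : A} (hkj : k ≤ j)
    (h : imageDeg π (k + 1) ≤ (imageDeg π k).map (LinearMap.mulLeft ℂ l)) :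
    imageDeg π (j + 1) ≤ (imageDeg π j).map (LinearMap.mulLeft ℂ l) := by
  induction j, hkj using Nat.le_induction with
  | base => exact h
  | succ j _ ih =>
    rw [add_comm, ← imageDeg_mul, Submodule.mul_le]
    intro a ha b hb
    obtain ⟨c, hc, rfl⟩ := ih hb
    refine ⟨a * c, ?_, ?_⟩
    · rw [add_comm, ← imageDeg_mul]
      exact Submodule.mul_mem_mul ha hc
    · simp only [LinearMap.mulLeft_apply]
      ring

lemma exists_momentForm_imageDeg_le {k : ℕ}
    (h : Module.finrank ℂ (imageDeg π (k + 1)) ≤ k + 1) :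
    ∃ t, imageDeg π (k + 1) ≤
      (imageDeg π k).map (LinearMap.mulLeft ℂ (π (momentForm t))) := by
  obtain ⟨t, ht⟩ := (finite_setOf_not_map_le k π.toLinearMap h).infinite_compl.nonempty
  refine ⟨t, (not_not.1 ht).trans ?_⟩
  rintro _ ⟨F, hF, rfl⟩
  exact ⟨π F, mem_imageDeg hF, by simp⟩

lemma imageDeg_ne_bot [Nontrivial A] {s : ℕ} {Φ : A →ₗ[ℂ] ℂ}
    (hΦ : ∀ j k, j + k = s → ∀ a ∈ imageDeg π j, (∀ b ∈ imageDeg π k, Φ (a * b) = 0) → a = 0)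
    {k : ℕ} (hk : k ≤ s) : imageDeg π k ≠ ⊥ := by
  intro h
  have hs : imageDeg π s = ⊥ := by
    rw [← Nat.add_sub_cancel' hk, ← imageDeg_mul, h, Submodule.bot_mul]
  refine one_ne_zero (hΦ 0 s (zero_add s) 1 one_mem_imageDeg fun b hb => ?_)
  rw [hs, Submodule.mem_bot] at hb
  simp [hb]

lemma finrank_imageDeg_le {s : ℕ} {Φ : A →ₗ[ℂ] ℂ}
    (hΦ : ∀ j k, j + k = s → ∀ a ∈ imageDeg π j, (∀ b ∈ imageDeg π k, Φ (a * b) = 0) → a = 0)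
    {j k : ℕ} (hjk : j + k = s) :
    Module.finrank ℂ (imageDeg π j) ≤ Module.finrank ℂ (imageDeg π k) := by
  rw [← Subspace.dual_finrank_eq (V := imageDeg π k)]
  let B : imageDeg π j →ₗ[ℂ] Module.Dual ℂ (imageDeg π k) :=
    ((LinearMap.mul ℂ A).compr₂ Φ).domRestrict₁₂ (imageDeg π j) (imageDeg π k)
  refine LinearMap.finrank_le_finrank_of_injective (f := B) ?_
  rw [injective_iff_map_eq_zero]
  intro a ha
  refine Subtype.ext (hΦ j k hjk a a.2 fun b hb => ?_)
  exact LinearMap.congr_fun ha ⟨b, hb⟩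

end GradedImage

/-- Commuting endomorphisms have a common eigenvector. -/
lemma exists_common_eigenvector {ι V : Type*} [Fintype ι] [AddCommGroup V] [Module ℂ V]
    [Module.Finite ℂ V] [Nontrivial V] (T : ι → Module.End ℂ V)
    (hT : ∀ i j v, T i (T j v) = T j (T i v)) :
    ∃ v ≠ 0, ∃ μ : ι → ℂ, ∀ i, T i v = μ i • v := by
  classical
  have key : ∀ s : Finset ι, ∃ W : Submodule ℂ V, W ≠ ⊥ ∧ (∀ j, ∀ w ∈ W, T j w ∈ W) ∧
      ∀ i ∈ s, ∃ μ : ℂ, ∀ w ∈ W, T i w = μ • w := by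
    intro s
    induction s using Finset.induction_on with
    | empty => exact ⟨⊤, top_ne_bot, by simp, by simp⟩
    | insert i s _ ih =>
      obtain ⟨W, hW, hinv, hs⟩ := ih
      have : Nontrivial W := Submodule.nontrivial_iff_ne_bot.2 hW
      obtain ⟨μ, hμ⟩ := Module.End.exists_eigenvalue ((T i).restrict (hinv i))
      obtain ⟨w, hw⟩ := hμ.exists_hasEigenvector
      refine ⟨W ⊓ Module.End.eigenspace (T i) μ, ?_, ?_, ?_⟩
      · refine (Submodule.ne_bot_iff _).2 ⟨w, ⟨w.2, ?_⟩, fun h => hw.2 (Subtype.ext h)⟩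
        exact Module.End.mem_eigenspace_iff.2 (congrArg Subtype.val hw.apply_eq_smul)
      · rintro j u ⟨hu, hu'⟩
        refine ⟨hinv j u hu, Module.End.mem_eigenspace_iff.2 ?_⟩
        rw [hT, Module.End.mem_eigenspace_iff.1 hu', map_smul]
      · intro j hj
        rcases Finset.mem_insert.1 hj with rfl | hj
        · exact ⟨μ, fun u hu => Module.End.mem_eigenspace_iff.1 hu.2⟩
        · obtain ⟨ν, hν⟩ := hs j hj
          exact ⟨ν, fun u hu => hν u hu.1⟩
  obtain ⟨W, hW, -, h⟩ := key Finset.univ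
  obtain ⟨v, hv, hv0⟩ := Submodule.exists_mem_ne_zero_of_ne_bot hW
  choose μ hμ using fun i => h i (Finset.mem_univ i)
  exact ⟨v, hv0, μ, fun i => hμ i v hv⟩

lemma aeval_zero_of_mem_homogeneousSubmodule {k : ℕ} {F : MvPolynomial (Fin 3) ℂ} (hk : k ≠ 0)
    (hF : F ∈ homogeneousSubmodule (Fin 3) ℂ k) : aeval (0 : Fin 3 → ℂ) F = 0 := by
  obtain ⟨k, rfl⟩ := Nat.exists_eq_succ_of_ne_zero hk
  have : homogeneousSubmodule (Fin 3) ℂ (k + 1) ≤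
      LinearMap.ker (aeval (R := ℂ) (0 : Fin 3 → ℂ)).toLinearMap :=
    homogeneousSubmodule_succ_le fun i g _ => by
      rw [LinearMap.mem_ker, AlgHom.toLinearMap_apply, map_mul, aeval_X, Pi.zero_apply, zero_mul]
  exact this hF

section Gorenstein

variable {A : Type*} [CommRing A] [Algebra ℂ A] [Nontrivial A]
  {π : MvPolynomial (Fin 3) ℂ →ₐ[ℂ] A} {m : ℕ} {Φ : A →ₗ[ℂ] ℂ}

/-- If the Hilbert function of a Gorenstein algebra is small in a low degree, the forms of degree
`2 * m + 1` in its ideal have a common zero. -/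
lemma exists_basePoint {k : ℕ}
    (hΦ : ∀ i j, i + j = 3 * m → ∀ a ∈ imageDeg π i, (∀ b ∈ imageDeg π j, Φ (a * b) = 0) → a = 0)
    (hk : k + 1 ≤ m) (h : Module.finrank ℂ (imageDeg π (k + 1)) ≤ k + 1) :
    ∃ p : Fin 3 → ℂ, p ≠ 0 ∧
      ∀ F ∈ homogeneousSubmodule (Fin 3) ℂ (2 * m + 1), π F = 0 → aeval p F = 0 := by
  obtain ⟨t, ht⟩ := exists_momentForm_imageDeg_le h
  set l := π (momentForm t) with hl
  have hl1 : l ∈ imageDeg π 1 := mem_imageDeg (momentForm_mem t)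
  have hx1 : ∀ i, π (X i) ∈ imageDeg π 1 := fun i => mem_imageDeg (isHomogeneous_X _ _)
  have hmul : ∀ {a} j, a ∈ imageDeg π 1 → ∀ b ∈ imageDeg π j, a * b ∈ imageDeg π (j + 1) := by
    intro a j ha b hb
    rw [add_comm, ← imageDeg_mul]
    exact Submodule.mul_mem_mul ha hb
  have hinj : ∀ j, j + k + 1 ≤ 3 * m → ∀ a ∈ imageDeg π j, l * a = 0 → a = 0 := by
    intro j hj a ha hla
    refine hΦ j (3 * m - j - 1 + 1) (by omega) a ha fun b hb => ?_
    obtain ⟨c, _, rfl⟩ := imageDeg_succ_le_of_le (by omega) ht hb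
    rw [LinearMap.mulLeft_apply, ← mul_assoc, mul_comm a, hla, zero_mul, map_zero]
  let M (a : A) (ha : a ∈ imageDeg π 1) : imageDeg π k →ₗ[ℂ] imageDeg π (k + 1) :=
    (LinearMap.mulLeft ℂ a).restrict (hmul k ha)
  have hbij : Function.Bijective (M l hl1) := by
    constructor
    · rw [injective_iff_map_eq_zero]
      intro a ha
      exact Subtype.ext (hinj k (by omega) a a.2 (congrArg Subtype.val ha))
    · rintro ⟨b, hb⟩
      obtain ⟨c, hc, rfl⟩ := ht hb
      exact ⟨⟨c, hc⟩, rfl⟩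
  let E := LinearEquiv.ofBijective (M l hl1) hbij
  let T (i : Fin 3) : Module.End ℂ (imageDeg π k) := E.symm.toLinearMap ∘ₗ M (π (X i)) (hx1 i)
  have hlT : ∀ i v, l * (T i v : A) = π (X i) * v := fun i v =>
    congrArg Subtype.val (E.apply_symm_apply (M (π (X i)) (hx1 i) v))
  have hcomm : ∀ i j v, T i (T j v) = T j (T i v) := by
    intro i j v
    rw [← sub_eq_zero]
    refine Subtype.ext (hinj k (by omega) _ (Subtype.prop _) ?_)
    refine hinj (k + 1) (by omega) _ (hmul k hl1 _ (Subtype.prop _)) ?_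
    have h1 := hlT i (T j v)
    have h2 := hlT j (T i v)
    have h3 := hlT i v
    have h4 := hlT j v
    push_cast
    linear_combination l * h1 - l * h2 + π (X i) * h4 - π (X j) * h3
  have : Nontrivial (imageDeg π k) :=
    Submodule.nontrivial_iff_ne_bot.2 (imageDeg_ne_bot hΦ (by omega))
  obtain ⟨v, hv, p, hp⟩ := exists_common_eigenvector T hcomm
  have hXv : ∀ i, π (X i) * v = p i • (l * (v : A)) := by
    intro i
    rw [← hlT, hp, Submodule.coe_smul, mul_smul_comm]
  have hFv : ∀ n, ∀ F ∈ homogeneousSubmodule (Fin 3) ℂ n,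
      π F * v = aeval p F • (l ^ n * (v : A)) := by
    intro n
    induction n with
    | zero =>
      intro F hF
      rw [homogeneousSubmodule_zero, Submodule.mem_one] at hF
      obtain ⟨c, rfl⟩ := hF
      rw [AlgHom.commutes, AlgHom.commutes, pow_zero, one_mul, ← Algebra.smul_def]
      rfl
    | succ n ih =>
      refine homogeneousSubmodule_succ_le (N := LinearMap.eqLocus
        (LinearMap.mulRight ℂ (v : A) ∘ₗ π.toLinearMap)
        (LinearMap.toSpanSingleton ℂ A (l ^ (n + 1) * (v : A)) ∘ₗ (aeval p).toLinearMap)) ?_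
      intro i g hg
      change π (X i * g) * v = aeval p (X i * g) • (l ^ (n + 1) * (v : A))
      rw [map_mul, map_mul, aeval_X, mul_assoc, ih g hg, mul_smul_comm, mul_left_comm, hXv,
        mul_smul_comm, smul_smul, pow_succ, mul_assoc, mul_comm (p i)]
  obtain ⟨_, ⟨G, hG, rfl⟩, hGv⟩ : ∃ b ∈ imageDeg π (3 * m - k), Φ (v * b) ≠ 0 := by
    by_contra! hcon
    exact hv (Subtype.ext (hΦ k (3 * m - k) (by omega) v v.2 hcon))
  replace hGv : Φ (aeval p G • (l ^ (3 * m - k) * (v : A))) ≠ 0 := by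
    rw [← hFv _ G hG, mul_comm]
    exact hGv
  refine ⟨p, ?_, fun F hF hπF => ?_⟩
  · rintro rfl
    rw [aeval_zero_of_mem_homogeneousSubmodule (by omega) hG, zero_smul, map_zero] at hGv
    exact hGv rfl
  · have h1 := hFv _ F hF
    rw [hπF, zero_mul] at h1
    by_contra hne
    have h2 := (smul_eq_zero.1 h1.symm).resolve_left hne
    apply hGv
    have h3 : 3 * m - k = (m - 1 - k) + (2 * m + 1) := by omega
    rw [h3, pow_add, mul_assoc, h2, mul_zero, smul_zero, map_zero]

lemma le_sum_finrank_imageDeg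
    (hΦ : ∀ i j, i + j = 3 * m → ∀ a ∈ imageDeg π i, (∀ b ∈ imageDeg π j, Φ (a * b) = 0) → a = 0)
    (hbp : ∀ p : Fin 3 → ℂ, p ≠ 0 →
      ∃ F ∈ homogeneousSubmodule (Fin 3) ℂ (2 * m + 1), π F = 0 ∧ aeval p F ≠ 0) :
    (m + 1) * (2 * m + 1) ≤ ∑ k ∈ Finset.range (3 * m + 1), Module.finrank ℂ (imageDeg π k) := by
  have low : ∀ k ≤ m, k + 1 ≤ Module.finrank ℂ (imageDeg π k) := by
    rintro (_ | k) hk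
    · exact Submodule.one_le_finrank_iff.2 (imageDeg_ne_bot hΦ (by omega))
    · by_contra! hcon
      obtain ⟨p, hp, h⟩ := exists_basePoint hΦ hk (Nat.lt_succ_iff.1 hcon)
      obtain ⟨F, hF, hF0, hpF⟩ := hbp p hp
      exact hpF (h F hF hF0)
  have mid : ∀ k, m ≤ k → k ≤ 2 * m → m + 1 ≤ Module.finrank ℂ (imageDeg π k) := by
    intro k hmk hk
    rcases hmk.eq_or_lt with rfl | hmk
    · exact low _ le_rfl
    obtain ⟨k, rfl⟩ : ∃ j, k = j + 1 := ⟨k - 1, by omega⟩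
    by_contra! hcon
    obtain ⟨t, ht⟩ := exists_momentForm_imageDeg_le (π := π) (k := k) (by omega)
    have anti : ∀ j, k + 1 ≤ j →
        Module.finrank ℂ (imageDeg π j) ≤ Module.finrank ℂ (imageDeg π (k + 1)) := by
      intro j hj
      induction j, hj using Nat.le_induction with
      | base => rfl
      | succ j hj ih =>
        exact ((Submodule.finrank_mono (imageDeg_succ_le_of_le (by omega) ht)).trans
          (Submodule.finrank_map_le _ _)).trans ih
    have h1 := anti (2 * m) hk
    have h2 := finrank_imageDeg_le hΦ (j := m) (k := 2 * m) (by omega)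
    have h3 := low m le_rfl
    omega
  have high : ∀ k < m, m - k ≤ Module.finrank ℂ (imageDeg π (m + (m + 1) + k)) := by
    intro k hk
    have h1 := finrank_imageDeg_le hΦ (j := m - k - 1) (k := m + (m + 1) + k) (by omega)
    have h2 := low (m - k - 1) (by omega)
    omega
  rw [show 3 * m + 1 = m + (m + 1) + m by ring, Finset.sum_range_add, Finset.sum_range_add,
    add_right_comm, ← Finset.sum_add_distrib]
  have h1 : ∑ _k ∈ Finset.range m, (m + 1) ≤ ∑ k ∈ Finset.range m,
      (Module.finrank ℂ (imageDeg π k) + Module.finrank ℂ (imageDeg π (m + (m + 1) + k))) := by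
    refine Finset.sum_le_sum fun k hk => ?_
    have hk := Finset.mem_range.1 hk
    have := low k hk.le
    have := high k hk
    omega
  have h2 : ∑ _k ∈ Finset.range (m + 1), (m + 1) ≤ ∑ k ∈ Finset.range (m + 1),
      Module.finrank ℂ (imageDeg π (m + k)) := by
    refine Finset.sum_le_sum fun k hk => ?_
    have hk := Finset.mem_range.1 hk
    exact mid _ (by omega) (by omega)
  simp only [Finset.sum_const, Finset.card_range, smul_eq_mul] at h1 h2
  nlinarith

end Gorenstein

/-- The Gorenstein quotient attached to a functional on forms of degree `s`. -/
lemma exists_gorenstein_quotient (φ : MvPolynomial (Fin 3) ℂ →ₗ[ℂ] ℂ) (s : ℕ)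
    (hφ : ∃ G ∈ homogeneousSubmodule (Fin 3) ℂ s, φ G ≠ 0) :
    ∃ (I : Ideal (MvPolynomial (Fin 3) ℂ)) (Φ : (MvPolynomial (Fin 3) ℂ ⧸ I) →ₗ[ℂ] ℂ),
      Nontrivial (MvPolynomial (Fin 3) ℂ ⧸ I) ∧
      (∀ F ∈ homogeneousSubmodule (Fin 3) ℂ s, Φ (Ideal.Quotient.mkₐ ℂ I F) = φ F) ∧
      ∀ j k, j + k = s → ∀ F ∈ homogeneousSubmodule (Fin 3) ℂ j,
        (∀ G ∈ homogeneousSubmodule (Fin 3) ℂ k, φ (F * G) = 0) →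
        Ideal.Quotient.mkₐ ℂ I F = 0 := by
  set φ' := φ ∘ₗ homogeneousComponent s with hφ'
  have hφs : ∀ F ∈ homogeneousSubmodule (Fin 3) ℂ s, φ' F = φ F := by
    intro F hF
    simp [hφ', homogeneousComponent_of_mem hF]
  let I : Ideal (MvPolynomial (Fin 3) ℂ) :=
    { carrier := {F | ∀ H, φ' (F * H) = 0}
      zero_mem' := fun H => by simp
      add_mem' := fun {F G} hF hG H => by rw [add_mul, map_add, hF, hG, add_zero]
      smul_mem' := fun c F hF H => by
        rw [smul_eq_mul, mul_comm c, mul_assoc]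
        exact hF _ }
  have hI : ∀ F, F ∈ I ↔ ∀ H, φ' (F * H) = 0 := fun F => Iff.rfl
  let Φ : (MvPolynomial (Fin 3) ℂ ⧸ I) →ₗ[ℂ] ℂ :=
    (Submodule.liftQ (I.restrictScalars ℂ) φ' (fun F hF => by
      have := (hI F).1 hF 1
      rwa [mul_one] at this)) ∘ₗ (Submodule.Quotient.restrictScalarsEquiv ℂ I).symm.toLinearMap
  refine ⟨I, Φ, ?_, fun F hF => hφs F hF, ?_⟩
  · obtain ⟨G, hG, hne⟩ := hφ
    refine Ideal.Quotient.nontrivial_iff.2 fun htop => hne ?_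
    have := (hI 1).1 (htop ▸ Submodule.mem_top) G
    rwa [one_mul, hφs G hG] at this
  · intro j k hjk F hF h
    refine Ideal.Quotient.eq_zero_iff_mem.2 ((hI F).2 fun H => ?_)
    rw [← sum_homogeneousComponent H, Finset.mul_sum, map_sum]
    refine Finset.sum_eq_zero fun i _ => ?_
    have hFi : F * homogeneousComponent i H ∈ homogeneousSubmodule (Fin 3) ℂ (j + i) :=
      IsHomogeneous.mul hF (homogeneousComponent_isHomogeneous i H)
    by_cases hik : i = k
    · subst hik
      rw [hjk] at hFi
      rw [hφs _ hFi]
      exact h _ (homogeneousComponent_isHomogeneous _ H)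
    · rw [hφ', LinearMap.comp_apply, homogeneousComponent_of_mem hFi, if_neg (by omega), map_zero]

/-- Polynomials of degree less than `n`. -/
noncomputable def degreeLTSubmodule (n : ℕ) : Submodule ℂ (MvPolynomial (Fin 3) ℂ) :=
  (Finset.range n).sup (homogeneousSubmodule (Fin 3) ℂ)

lemma degreeLTSubmodule_succ (n : ℕ) : degreeLTSubmodule (n + 1) =
    homogeneousSubmodule (Fin 3) ℂ n ⊔ degreeLTSubmodule n := by
  rw [degreeLTSubmodule, Finset.range_add_one, Finset.sup_insert, degreeLTSubmodule]

section Functional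

variable {B : Type*} [CommRing B] [Algebra ℂ B]
  {ev : MvPolynomial (Fin 3) ℂ →ₐ[ℂ] B} {lam : B →ₗ[ℂ] ℂ}

lemma map_mul_eq_zero_of_mem_degreeLT {s n : ℕ}
    (hkill : ∀ j < s, ∀ G ∈ homogeneousSubmodule (Fin 3) ℂ j, lam (ev G) = 0) (hn : n ≤ s)
    {F G : MvPolynomial (Fin 3) ℂ} (hF : F ∈ degreeLTSubmodule n)
    (hG : G ∈ homogeneousSubmodule (Fin 3) ℂ (s - n)) : lam (ev (F * G)) = 0 := by
  have : degreeLTSubmodule n ≤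
      LinearMap.ker ((lam ∘ₗ ev.toLinearMap) ∘ₗ LinearMap.mulRight ℂ G) := by
    refine Finset.sup_le fun j hj F hF => ?_
    have hj := Finset.mem_range.1 hj
    exact hkill (j + (s - n)) (by omega) _ (IsHomogeneous.mul hF hG)
  exact this hF

lemma sum_finrank_imageDeg_le [Module.Finite ℂ B] {A : Type*} [CommRing A] [Algebra ℂ A]
    {π : MvPolynomial (Fin 3) ℂ →ₐ[ℂ] A} {s : ℕ}
    (hkill : ∀ j < s, ∀ G ∈ homogeneousSubmodule (Fin 3) ℂ j, lam (ev G) = 0)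
    (hπ : ∀ j k, j + k = s → ∀ F ∈ homogeneousSubmodule (Fin 3) ℂ j,
      (∀ G ∈ homogeneousSubmodule (Fin 3) ℂ k, lam (ev (F * G)) = 0) → π F = 0) :
    ∑ k ∈ Finset.range (s + 1), Module.finrank ℂ (imageDeg π k) ≤ Module.finrank ℂ B := by
  have key : ∀ n ≤ s + 1, ∑ k ∈ Finset.range n, Module.finrank ℂ (imageDeg π k) ≤
      Module.finrank ℂ ((degreeLTSubmodule n).map ev.toLinearMap) := by
    intro n
    induction n with
    | zero => simp
    | succ n ih =>
      intro hn
      rw [Finset.sum_range_succ]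
      refine (Nat.add_le_add_right (ih (by omega)) _).trans ?_
      let r : homogeneousSubmodule (Fin 3) ℂ n →ₗ[ℂ] imageDeg π n :=
        π.toLinearMap.restrict fun F hF => mem_imageDeg hF
      have hr : LinearMap.range r = ⊤ := LinearMap.range_eq_top.2 fun ⟨_, F, hF, rfl⟩ => ⟨⟨F, hF⟩, rfl⟩
      obtain ⟨σ, hσ⟩ := r.exists_rightInverse_of_surjective hr
      have hσ' : ∀ a, π (σ a : MvPolynomial (Fin 3) ℂ) = a := fun a =>
        congrArg Subtype.val (LinearMap.congr_fun hσ a)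
      let f := LinearMap.coprod (Submodule.subtype ((degreeLTSubmodule n).map ev.toLinearMap))
        (ev.toLinearMap ∘ₗ Submodule.subtype _ ∘ₗ σ)
      have hf : Function.Injective f := by
        rw [injective_iff_map_eq_zero]
        rintro ⟨⟨_, F, hF, rfl⟩, a⟩ h
        replace h : ev F + ev (σ a) = 0 := h
        have ha : a = 0 := by
          refine Subtype.ext ((hσ' a).symm.trans
            (hπ n (s - n) (by omega) _ (σ a).2 fun G hG => ?_))
          rw [map_mul, ← neg_eq_of_add_eq_zero_right h, neg_mul, ← map_mul, map_neg,
            map_mul_eq_zero_of_mem_degreeLT hkill (by omega) hF hG, neg_zero]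
        subst ha
        refine Prod.ext (Subtype.ext ?_) rfl
        simpa using h
      rw [← Module.finrank_prod, ← LinearMap.finrank_range_of_inj hf]
      refine Submodule.finrank_mono ?_
      rintro _ ⟨⟨⟨_, F, hF, rfl⟩, a⟩, rfl⟩
      refine ⟨F + σ a, ?_, map_add ev _ _⟩
      rw [degreeLTSubmodule_succ, add_comm]
      exact Submodule.add_mem_sup (σ a).2 hF
  exact (key _ le_rfl).trans (Submodule.finrank_le _)

lemma le_finrank_of_functional [Module.Finite ℂ B] {m : ℕ}
    (hkill : ∀ j < 3 * m, ∀ G ∈ homogeneousSubmodule (Fin 3) ℂ j, lam (ev G) = 0)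
    (hne : ∃ G ∈ homogeneousSubmodule (Fin 3) ℂ (3 * m), lam (ev G) ≠ 0)
    (hbp : ∀ p : Fin 3 → ℂ, p ≠ 0 → ∃ F ∈ homogeneousSubmodule (Fin 3) ℂ (2 * m + 1),
      (∀ G ∈ homogeneousSubmodule (Fin 3) ℂ (3 * m - (2 * m + 1)), lam (ev (F * G)) = 0) ∧
      aeval p F ≠ 0) (hm : 1 ≤ m) :
    (m + 1) * (2 * m + 1) ≤ Module.finrank ℂ B := by
  obtain ⟨I, Φ, hnt, hΦ, hI⟩ := exists_gorenstein_quotient (lam ∘ₗ ev.toLinearMap) (3 * m) hne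
  refine (le_sum_finrank_imageDeg (π := Ideal.Quotient.mkₐ ℂ I) (Φ := Φ) ?_ ?_).trans
    (sum_finrank_imageDeg_le (π := Ideal.Quotient.mkₐ ℂ I) hkill hI)
  · rintro i j hij _ ⟨F, hF, rfl⟩ h
    refine hI i j hij F hF fun G hG => ?_
    rw [← hΦ _ (by rw [← hij]; exact IsHomogeneous.mul hF hG), map_mul]
    exact h _ (mem_imageDeg hG)
  · intro p hp
    obtain ⟨F, hF, hFG, hpF⟩ := hbp p hp
    exact ⟨F, hF, hI _ _ (by omega) F hF hFG, hpF⟩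

/-- A functional killing low degrees can be twisted to be nonzero in a prescribed degree. -/
lemma exists_twist {s : ℕ}
    (hkill : ∀ j < s, ∀ G ∈ homogeneousSubmodule (Fin 3) ℂ j, lam (ev G) = 0)
    (hne : ∃ G, lam (ev G) ≠ 0) :
    ∃ H, (∀ j < s, ∀ G ∈ homogeneousSubmodule (Fin 3) ℂ j, lam (ev (H * G)) = 0) ∧
      ∃ G ∈ homogeneousSubmodule (Fin 3) ℂ s, lam (ev (H * G)) ≠ 0 := by
  classical
  have hex : ∃ n, ∃ G ∈ homogeneousSubmodule (Fin 3) ℂ n, lam (ev G) ≠ 0 := by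
    by_contra! hcon
    obtain ⟨G, hG⟩ := hne
    refine hG ?_
    rw [← sum_homogeneousComponent G, map_sum, map_sum]
    exact Finset.sum_eq_zero fun i _ => hcon i _ (homogeneousComponent_isHomogeneous _ _)
  set n := Nat.find hex
  have hmin : ∀ j < n, ∀ G ∈ homogeneousSubmodule (Fin 3) ℂ j, lam (ev G) = 0 := by
    intro j hj G hG
    by_contra h
    exact Nat.find_min hex hj ⟨G, hG, h⟩
  obtain ⟨F, hF, hFne⟩ := Nat.find_spec hex
  have hsn : s ≤ n := by
    by_contra! h
    exact hFne (hkill n h F hF)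
  obtain ⟨H, hH, G, hG, hne'⟩ : ∃ H ∈ homogeneousSubmodule (Fin 3) ℂ (n - s),
      ∃ G ∈ homogeneousSubmodule (Fin 3) ℂ s, lam (ev (H * G)) ≠ 0 := by
    by_contra! hcon
    have : homogeneousSubmodule (Fin 3) ℂ (n - s + s) ≤
        LinearMap.ker (lam ∘ₗ ev.toLinearMap) := homogeneousSubmodule_add_le hcon
    rw [Nat.sub_add_cancel hsn] at this
    exact hFne (this hF)
  refine ⟨H, fun j hj G hG => ?_, G, hG, hne'⟩
  exact hmin (n - s + j) (by omega) _ (IsHomogeneous.mul hH hG)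

end Functional

lemma exists_separating {ι σ : Type*} [Fintype ι] (q : ι → σ → ℂ) (hq : Function.Injective q)
    (p : ι) : ∃ F : MvPolynomial σ ℂ, aeval (q p) F ≠ 0 ∧ ∀ p' ≠ p, aeval (q p') F = 0 := by
  classical
  have hsep : ∀ p', ∃ G : MvPolynomial σ ℂ, p' ≠ p → aeval (q p) G ≠ 0 ∧ aeval (q p') G = 0 := by
    intro p'
    by_cases h : p' = p
    · exact ⟨0, fun h' => absurd h h'⟩
    · obtain ⟨i, hi⟩ := Function.ne_iff.1 (hq.ne h)
      refine ⟨X i - C (q p' i), fun _ => ⟨?_, by simp⟩⟩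
      simpa [sub_eq_zero] using Ne.symm hi
  choose G hG using hsep
  refine ⟨∏ p' ∈ Finset.univ.erase p, G p', ?_, fun p' hp' => ?_⟩
  · rw [map_prod]
    exact Finset.prod_ne_zero_iff.2 fun p' hp' => (hG p' (Finset.ne_of_mem_erase hp')).1
  · rw [map_prod]
    exact Finset.prod_eq_zero (Finset.mem_erase.2 ⟨hp', Finset.mem_univ _⟩) (hG p' hp').2

lemma aeval_smul_of_mem {σ : Type*} {n : ℕ} {F : MvPolynomial σ ℂ}
    (hF : F ∈ homogeneousSubmodule σ ℂ n) (c : ℂ) (x : σ → ℂ) :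
    aeval (c • x) F = c ^ n * aeval x F := by
  induction n generalizing F with
  | zero =>
    rw [homogeneousSubmodule_zero, Submodule.mem_one] at hF
    obtain ⟨b, rfl⟩ := hF
    simp
  | succ n ih =>
    have : homogeneousSubmodule σ ℂ (n + 1) ≤ LinearMap.eqLocus (aeval (c • x)).toLinearMap
        (c ^ (n + 1) • (aeval x).toLinearMap) := by
      refine homogeneousSubmodule_succ_le fun i G hG => ?_
      simp only [LinearMap.mem_eqLocus, AlgHom.toLinearMap_apply, LinearMap.smul_apply, map_mul,
        ih hG, aeval_X, Pi.smul_apply, smul_eq_mul]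
      ring
    exact this hF

/-- Substitution of `c + a` for the last variable. -/
noncomputable def substLast (a : MvPolynomial (Fin 3) ℂ) (c : ℂ) :
    MvPolynomial (Fin 4) ℂ →ₐ[ℂ] MvPolynomial (Fin 3) ℂ :=
  aeval (Fin.snoc (α := fun _ => MvPolynomial (Fin 3) ℂ) X (C c + a))

lemma substLast_castSucc (a : MvPolynomial (Fin 3) ℂ) (c : ℂ) (i : Fin 3) :
    substLast a c (X i.castSucc) = X i := by
  rw [substLast, aeval_X, Fin.snoc_castSucc]

lemma substLast_last (a : MvPolynomial (Fin 3) ℂ) (c : ℂ) :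
    substLast a c (X (Fin.last 3)) = C c + a := by
  rw [substLast, aeval_X, Fin.snoc_last]

lemma aeval_substLast (a : MvPolynomial (Fin 3) ℂ) (c : ℂ) (x : Fin 3 → ℂ)
    (F : MvPolynomial (Fin 4) ℂ) :
    aeval x (substLast a c F) =
      aeval (Fin.snoc (α := fun _ => ℂ) x (c + aeval x a)) F := by
  rw [← AlgHom.comp_apply]
  congr 1
  ext i
  induction i using Fin.lastCases with
  | last => rw [AlgHom.comp_apply, substLast_last, aeval_X, Fin.snoc_last, map_add, aeval_C]; rfl
  | cast i => simp [substLast_castSucc]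

section Subst

variable {a : MvPolynomial (Fin 3) ℂ} (ha : a ∈ homogeneousSubmodule (Fin 3) ℂ 1)
include ha

lemma mul_mem_succ_of_linear {n : ℕ} {G : MvPolynomial (Fin 3) ℂ}
    (hG : G ∈ homogeneousSubmodule (Fin 3) ℂ n) :
    a * G ∈ homogeneousSubmodule (Fin 3) ℂ (n + 1) := by
  rw [add_comm]
  exact IsHomogeneous.mul ha hG

lemma mul_mem_degreeLT {n : ℕ} {G : MvPolynomial (Fin 3) ℂ}
    (hG : G ∈ degreeLTSubmodule n) : a * G ∈ degreeLTSubmodule (n + 1) := by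
  have : degreeLTSubmodule n ≤ (degreeLTSubmodule (n + 1)).comap (LinearMap.mulLeft ℂ a) := by
    refine Finset.sup_le fun j hj F hF => ?_
    exact Finset.le_sup (f := homogeneousSubmodule (Fin 3) ℂ)
      (Finset.mem_range.2 (Nat.succ_lt_succ (Finset.mem_range.1 hj))) (mul_mem_succ_of_linear ha hF)
  exact this hG

lemma substLast_zero_mem {n : ℕ} {F : MvPolynomial (Fin 4) ℂ}
    (hF : F ∈ homogeneousSubmodule (Fin 4) ℂ n) :
    substLast a 0 F ∈ homogeneousSubmodule (Fin 3) ℂ n := by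
  induction n generalizing F with
  | zero =>
    rw [homogeneousSubmodule_zero, Submodule.mem_one] at hF ⊢
    obtain ⟨b, rfl⟩ := hF
    exact ⟨b, by simp⟩
  | succ n ih =>
    have : homogeneousSubmodule (Fin 4) ℂ (n + 1) ≤
        (homogeneousSubmodule (Fin 3) ℂ (n + 1)).comap (substLast a 0).toLinearMap := by
      refine homogeneousSubmodule_succ_le fun i G hG => ?_
      rw [Submodule.mem_comap, AlgHom.toLinearMap_apply, map_mul]
      induction i using Fin.lastCases with
      | last =>
        rw [substLast_last, map_zero, zero_add]
        exact mul_mem_succ_of_linear ha (ih hG)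
      | cast i =>
        rw [substLast_castSucc]
        exact mul_mem_succ_of_linear (isHomogeneous_X _ _) (ih hG)
    exact this hF

lemma substLast_sub_mem {n : ℕ} {F : MvPolynomial (Fin 4) ℂ}
    (hF : F ∈ homogeneousSubmodule (Fin 4) ℂ n) :
    substLast a 1 F - substLast a 0 F ∈ degreeLTSubmodule n := by
  induction n generalizing F with
  | zero =>
    rw [homogeneousSubmodule_zero, Submodule.mem_one] at hF
    obtain ⟨b, rfl⟩ := hF
    simp
  | succ n ih =>
    have : homogeneousSubmodule (Fin 4) ℂ (n + 1) ≤ (degreeLTSubmodule (n + 1)).comap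
        ((substLast a 1).toLinearMap - (substLast a 0).toLinearMap) := by
      refine homogeneousSubmodule_succ_le fun i G hG => ?_
      rw [Submodule.mem_comap, LinearMap.sub_apply, AlgHom.toLinearMap_apply,
        AlgHom.toLinearMap_apply, map_mul, map_mul]
      induction i using Fin.lastCases with
      | last =>
        have h1 : substLast a 1 G ∈ degreeLTSubmodule (n + 1) := by
          rw [degreeLTSubmodule_succ, ← add_sub_cancel (substLast a 0 G) (substLast a 1 G)]
          exact Submodule.add_mem_sup (substLast_zero_mem ha hG) (ih hG)
        rw [substLast_last, substLast_last]
        convert Submodule.add_mem _ h1 (mul_mem_degreeLT ha (ih hG)) using 1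
        simp only [map_one, map_zero]
        ring
      | cast i =>
        rw [substLast_castSucc, substLast_castSucc, ← mul_sub]
        exact mul_mem_degreeLT (isHomogeneous_X _ _) (ih hG)
    exact this hF

/-- Passing from homogeneous coordinates `y` with `y 3 ≠ a y` to affine coordinates. -/
lemma aeval_eq_pow_mul_aeval_substLast {n : ℕ} {F : MvPolynomial (Fin 4) ℂ}
    (hF : F ∈ homogeneousSubmodule (Fin 4) ℂ n) {y : Fin 4 → ℂ} {l : ℂ} (hl : l ≠ 0)
    (hy : y (Fin.last 3) - aeval (fun i : Fin 3 => y i.castSucc) a = l) :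
    aeval y F = l ^ n * aeval (l⁻¹ • fun i : Fin 3 => y i.castSucc) (substLast a 1 F) := by
  rw [aeval_substLast, ← aeval_smul_of_mem hF]
  congr 2
  ext i
  induction i using Fin.lastCases with
  | last =>
    rw [Pi.smul_apply, Fin.snoc_last, aeval_smul_of_mem ha, smul_eq_mul, ← hy]
    rw [← hy] at hl
    field_simp
    ring
  | cast i =>
    rw [Pi.smul_apply, Fin.snoc_castSucc, Pi.smul_apply, smul_inv_smul₀ hl]

/-- Homogenisation with respect to the linear form `X 3 - a`. -/
lemma exists_homogenization {j n : ℕ} (hjn : j ≤ n) {G : MvPolynomial (Fin 3) ℂ}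
    (hG : G ∈ homogeneousSubmodule (Fin 3) ℂ j) :
    ∃ F ∈ homogeneousSubmodule (Fin 4) ℂ n, substLast a 1 F = G := by
  have hr : ∀ H : MvPolynomial (Fin 3) ℂ, substLast a 1 (rename Fin.castSucc H) = H := by
    intro H
    rw [← AlgHom.comp_apply]
    conv_rhs => rw [← AlgHom.id_apply (R := ℂ) H]
    congr 1
    ext i
    simp [substLast_castSucc]
  refine ⟨rename Fin.castSucc G * (X (Fin.last 3) - rename Fin.castSucc a) ^ (n - j), ?_, ?_⟩
  · have h1 : (X (Fin.last 3) - rename Fin.castSucc a : MvPolynomial (Fin 4) ℂ).IsHomogeneous 1 :=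
      (isHomogeneous_X _ _).sub (IsHomogeneous.rename_isHomogeneous ha)
    have := (IsHomogeneous.rename_isHomogeneous (f := Fin.castSucc) hG).mul (h1.pow (n - j))
    rwa [one_mul, Nat.add_sub_cancel' hjn] at this
  · rw [map_mul, map_pow, map_sub, hr, hr, substLast_last, add_sub_cancel_right, map_one, one_pow,
      mul_one]

end Subst

lemma exists_linear_ne_zero {ι : Type*} [Finite ι] (y : ι → Fin 4 → ℂ) (hy : ∀ p, y p ≠ 0) :
    ∃ a ∈ homogeneousSubmodule (Fin 3) ℂ 1,
      ∀ p, y p (Fin.last 3) - aeval (fun i : Fin 3 => y p i.castSucc) a ≠ 0 := by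
  let P : ι → Polynomial ℂ := fun p => Polynomial.C (y p 3) - Polynomial.C (y p 0) * Polynomial.X -
    Polynomial.C (y p 1) * Polynomial.X ^ 2 - Polynomial.C (y p 2) * Polynomial.X ^ 3
  have hP : ∀ p, P p ≠ 0 := by
    intro p h
    refine hy p (funext fun i => ?_)
    have hc : ∀ n, (P p).coeff n = 0 := fun n => by rw [h, Polynomial.coeff_zero]
    have h0 := hc 0
    have h1 := hc 1
    have h2 := hc 2
    have h3 := hc 3
    simp [P, Polynomial.coeff_X, Polynomial.coeff_X_pow, Polynomial.coeff_C] at h0 h1 h2 h3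
    fin_cases i <;> simp [h0, h1, h2, h3]
  have hfin : (⋃ p, {t | (P p).IsRoot t}).Finite :=
    Set.finite_iUnion fun p => Polynomial.finite_setOfPred_isRoot (hP p)
  obtain ⟨t, ht⟩ := hfin.exists_notMem
  refine ⟨t • momentForm t, Submodule.smul_mem _ _ (momentForm_mem t), fun p h => ht ?_⟩
  refine Set.mem_iUnion.2 ⟨p, ?_⟩
  rw [Set.mem_ofPred_eq, Polynomial.IsRoot, ← h]
  simp [P, momentForm]
  ring

/-- If the singular points of a surface of degree `2 * (m + 1)` in `ℙ³` fail to impose independent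
conditions on forms of degree `3 * m - 1`, there are at least `(m + 1) * (2 * m + 1)` of them. -/
lemma le_card_of_functional {ι : Type*} [Fintype ι] {y : ι → Fin 4 → ℂ} (hy : ∀ p, y p ≠ 0)
    (hinj : ∀ p p', ∀ c : ℂ, y p = c • y p' → p = p') {m : ℕ} (hm : 1 ≤ m)
    {f : MvPolynomial (Fin 4) ℂ} (hf : f.IsHomogeneous (2 * (m + 1)))
    (hsing : ∀ p i, aeval (y p) (pderiv i f) = 0)
    (hall : ∀ z ≠ 0, (∀ i, aeval z (pderiv i f) = 0) → ∃ p, ∃ c : ℂ, y p = c • z)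
    {lam : (ι → ℂ) →ₗ[ℂ] ℂ} (hlam : lam ≠ 0)
    (hkill : ∀ F ∈ homogeneousSubmodule (Fin 4) ℂ (3 * m - 1), lam (fun p => aeval (y p) F) = 0) :
    (m + 1) * (2 * m + 1) ≤ Fintype.card ι := by
  classical
  obtain ⟨a, ha, hl⟩ := exists_linear_ne_zero y hy
  set l : ι → ℂ := fun p => y p (Fin.last 3) - aeval (fun i : Fin 3 => y p i.castSucc) a with hldef
  set q : ι → Fin 3 → ℂ := fun p => (l p)⁻¹ • fun i : Fin 3 => y p i.castSucc with hq
  have heval : ∀ (n : ℕ) (F : MvPolynomial (Fin 4) ℂ), F ∈ homogeneousSubmodule (Fin 4) ℂ n →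
      ∀ p, aeval (y p) F = l p ^ n * aeval (q p) (substLast a 1 F) := fun n F hF p =>
    aeval_eq_pow_mul_aeval_substLast ha hF (hl p) rfl
  have hqinj : Function.Injective q := by
    intro p p' h
    have hX : ∀ i p, y p i = l p * aeval (q p) (substLast a 1 (X i)) := fun i p => by
      have := heval 1 (X i) (isHomogeneous_X _ _) p
      rwa [aeval_X, pow_one] at this
    refine hinj p p' (l p / l p') (funext fun i => ?_)
    rw [Pi.smul_apply, smul_eq_mul, hX i p, hX i p', h]
    rw [← mul_assoc, div_mul_cancel₀ _ (hl p')]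
  let ev : MvPolynomial (Fin 3) ℂ →ₐ[ℂ] (ι → ℂ) := AlgHom.pi fun p => aeval (q p)
  have hev : ∀ F p, ev F p = aeval (q p) F := fun F p => rfl
  let lam1 : (ι → ℂ) →ₗ[ℂ] ℂ := lam ∘ₗ LinearMap.mulLeft ℂ (fun p => l p ^ (3 * m - 1))
  have hkill1 : ∀ j < 3 * m, ∀ G ∈ homogeneousSubmodule (Fin 3) ℂ j, lam1 (ev G) = 0 := by
    intro j hj G hG
    obtain ⟨F, hF, rfl⟩ := exists_homogenization ha (n := 3 * m - 1) (by omega) hG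
    rw [← hkill F hF]
    exact congrArg lam (funext fun p => (heval _ F hF p).symm)
  have hne1 : ∃ G, lam1 (ev G) ≠ 0 := by
    obtain ⟨p, hp⟩ : ∃ p, lam (Pi.single p 1) ≠ 0 := by
      by_contra! h
      refine hlam (LinearMap.pi_ext' fun p => LinearMap.ext_ring ?_)
      simpa using h p
    obtain ⟨F, hFp, hF⟩ := exists_separating q hqinj p
    refine ⟨F, ?_⟩
    have : (fun p => l p ^ (3 * m - 1)) * ev F =
        (l p ^ (3 * m - 1) * aeval (q p) F) • Pi.single p (1 : ℂ) := by
      ext p'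
      by_cases h : p' = p
      · subst h; simp [hev]
      · simp [hev, hF p' h, h]
    rw [LinearMap.comp_apply, LinearMap.mulLeft_apply, this, map_smul, smul_eq_mul]
    exact mul_ne_zero (mul_ne_zero (pow_ne_zero _ (hl p)) hFp) hp
  obtain ⟨H, hH, hne⟩ := exists_twist hkill1 hne1
  let lam2 : (ι → ℂ) →ₗ[ℂ] ℂ := lam1 ∘ₗ LinearMap.mulLeft ℂ (ev H)
  have hlam2 : ∀ G, lam2 (ev G) = lam1 (ev (H * G)) := fun G => by rw [map_mul]; rfl
  rw [← Module.finrank_fintype_fun_eq_card ℂ]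
  have hkill2 : ∀ j < 3 * m, ∀ G ∈ homogeneousSubmodule (Fin 3) ℂ j, lam2 (ev G) = 0 :=
    fun j hj G hG => (hlam2 G).trans (hH j hj G hG)
  refine le_finrank_of_functional (ev := ev) (lam := lam2) hkill2 ?_ ?_ hm
  · obtain ⟨G, hG, h⟩ := hne
    exact ⟨G, hG, by rwa [hlam2]⟩
  · intro p hp
    set z : Fin 4 → ℂ := Fin.snoc (α := fun _ => ℂ) p (0 + aeval p a) with hz
    have hz0 : z ≠ 0 := by
      intro h
      refine hp (funext fun i => ?_)
      have := congrFun h i.castSucc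
      rwa [hz, Fin.snoc_castSucc] at this
    obtain ⟨i, hi⟩ : ∃ i, aeval z (pderiv i f) ≠ 0 := by
      by_contra! h
      obtain ⟨p', c, hc⟩ := hall z hz0 h
      refine hl p' ?_
      have : (fun i : Fin 3 => y p' i.castSucc) = c • p := by
        ext i
        rw [hc, Pi.smul_apply, hz, Fin.snoc_castSucc, Pi.smul_apply]
      rw [this, aeval_smul_of_mem ha, hc, Pi.smul_apply, hz, Fin.snoc_last, smul_eq_mul]
      ring
    have hdf : pderiv i f ∈ homogeneousSubmodule (Fin 4) ℂ (2 * m + 1) := hf.pderiv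
    refine ⟨substLast a 0 (pderiv i f), substLast_zero_mem ha hdf, fun G hG => ?_, ?_⟩
    · have h1 : ev (substLast a 1 (pderiv i f)) = 0 := by
        ext p'
        have := heval _ _ hdf p'
        rw [hsing, eq_comm] at this
        exact (mul_eq_zero.1 this).resolve_left (pow_ne_zero _ (hl p'))
      have h2 := map_mul_eq_zero_of_mem_degreeLT hkill2 (by omega) (substLast_sub_mem ha hdf) hG
      rw [map_mul, map_sub, h1, zero_sub, neg_mul, map_neg, neg_eq_zero, ← map_mul] at h2
      exact h2
    · rwa [aeval_substLast]

lemma exists_functional_of_hilb_lt {m k : ℕ} {S : Set (Projectivization ℂ (Fin m → ℂ))} [Fintype S]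
    (h : hilb m (coneVanishingIdeal m S) k < Fintype.card S) :
    ∃ lam : (S → ℂ) →ₗ[ℂ] ℂ, lam ≠ 0 ∧ ∀ F ∈ homogeneousSubmodule (Fin m) ℂ k,
      lam (fun p => aeval (Projectivization.rep (p : Projectivization ℂ (Fin m → ℂ))) F) = 0 := by
  let ev : MvPolynomial (Fin m) ℂ →ₐ[ℂ] (S → ℂ) := AlgHom.pi fun p : S => aeval p.1.rep
  let r : homogeneousSubmodule (Fin m) ℂ k →ₗ[ℂ] (S → ℂ) := ev.toLinearMap ∘ₗ Submodule.subtype _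
  have hker : coneVanishingIdeal m S ≤ RingHom.ker ev := by
    refine Ideal.span_le.2 fun g hg => ?_
    refine (RingHom.mem_ker).2 (funext fun p => ?_)
    have := hg p.1 p.2 1
    rwa [one_smul] at this
  have hlt : LinearMap.range r < ⊤ := by
    refine lt_top_iff_ne_top.2 fun htop => h.not_ge ?_
    let r' := Submodule.liftQ (Submodule.comap (homogeneousSubmodule (Fin m) ℂ k).subtype
      (Submodule.restrictScalars ℂ (coneVanishingIdeal m S))) r fun F hF => hker hF
    have hr' : Function.Surjective r' := fun c =>
      let ⟨x, hx⟩ := LinearMap.range_eq_top.1 htop c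
      ⟨Submodule.Quotient.mk x, hx⟩
    have : Module.Finite ℂ (homogeneousSubmodule (Fin m) ℂ k) :=
      Module.Finite.iff_fg.2 (homogeneousSubmodule_fg (Fin m) ℂ k)
    rw [← Module.finrank_fintype_fun_eq_card ℂ, hilb]
    exact LinearMap.finrank_le_finrank_of_surjective hr'
  obtain ⟨lam, hne, hle⟩ := Submodule.exists_le_ker_of_lt_top _ hlt
  exact ⟨lam, hne, fun F hF => hle ⟨⟨F, hF⟩, rfl⟩⟩

/-- if `V(f) ⊂ ℙ^3` is a nodal surface of degree `2d` (`f` squarefree)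
and the double cover `X : y² = f` has defect (`h^4(X,ℚ) > 1`; via the weighted Dimca
formula, the nodes fail to impose independent conditions in degree `3d - 4`), then
`X` has at least `d(2d-1)` nodes. -/
theorem double_cover_defect_nodes_ge (d : ℕ) (hd : 1 ≤ d)
    (f : MvPolynomial (Fin 4) ℂ) (hsf : Squarefree f) (hf : f.IsHomogeneous (2 * d))
    (hnodal : IsNodal 4 f)
    (hdefect : hilb 4 (coneVanishingIdeal 4 (singLocus 4 f)) (3 * d - 4) <
      (singLocus 4 f).ncard) :
    d * (2 * d - 1) ≤ (singLocus 4 f).ncard := by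
  have hpos : 0 < (singLocus 4 f).ncard := by omega
  obtain ⟨m, rfl⟩ : ∃ m, d = m + 1 := ⟨d - 1, by omega⟩
  rcases Nat.eq_zero_or_pos m with rfl | hm
  · rwa [zero_add, one_mul]
  have := (Set.finite_of_ncard_pos hpos).fintype
  rw [← Nat.card_coe_set_eq, Nat.card_eq_fintype_card] at hdefect ⊢
  obtain ⟨lam, hne, hkill⟩ := exists_functional_of_hilb_lt hdefect
  have hrep : ∀ (p : Projectivization ℂ (Fin 4 → ℂ)) (z : Fin 4 → ℂ) (hz : z ≠ 0) (c : ℂ),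
      p.rep = c • z → p = Projectivization.mk ℂ z hz := by
    intro p z hz c h
    rw [← p.mk_rep]
    exact (Projectivization.mk_eq_mk_iff' ℂ _ _ _ _).2 ⟨c, h.symm⟩
  refine le_card_of_functional (y := fun p : singLocus 4 f => p.1.rep) (fun p => p.1.rep_nonzero)
    (fun p p' c h => Subtype.ext ?_) hm hf (fun p i => p.2 i) (fun z hz h => ?_) hne ?_
  · exact (hrep _ _ p'.1.rep_nonzero c h).trans p'.1.mk_rep
  · obtain ⟨c, hc⟩ := Projectivization.exists_smul_eq_mk_rep ℂ z hz
    refine ⟨⟨Projectivization.mk ℂ z hz, fun i => ?_⟩, c, hc.symm⟩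
    have hdf : pderiv i f ∈ homogeneousSubmodule (Fin 4) ℂ (2 * (m + 1) - 1) := hf.pderiv
    rw [← hc, ← aeval_eq_eval]
    change aeval ((c : ℂ) • z) (pderiv i f) = 0
    rw [aeval_smul_of_mem hdf, h, mul_zero]
  · exact hkill
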